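/- Let f : ℝⁿ → ℝ be smooth with Δ²f = 0 (biharmonic) and suppose f has finite bienergy ∫|Δf|² < ∞ and finite energy ∫|∇f|² < ∞, and that Δf and ∇f are bounded. Then Δf = 0, i.e. f is harmonic. -/

import Mathlib

open MeasureTheory

/-- The Euclidean Laplacian `Δf = Σᵢ ∂²f/∂xᵢ²` on `ℝⁿ`. -/
noncomputable def euclideanLap {n : ℕ} (f : EuclideanSpace ℝ (Fin n) → ℝ)
    (x : EuclideanSpace ℝ (Fin n)) : ℝ :=
  ∑ i : Fin n,
    iteratedFDeriv ℝ 2 f x ![EuclideanSpace.single i 1, EuclideanSpace.single i 1]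

section SecondDirectionalDerivative

variable {E : Type*} [NormedAddCommGroup E] [NormedSpace ℝ E]

theorem ContDiff.fderiv_apply_const {u : E → ℝ} (hu : ContDiff ℝ (⊤ : ℕ∞) u) (v : E) :
    ContDiff ℝ (⊤ : ℕ∞) (fun y => fderiv ℝ u y v) :=
  (hu.fderiv_right (m := (⊤ : ℕ∞)) (by simp)).clm_apply contDiff_const

/-- The second directional derivative of `u²` is `2 u ∂ᵥ²u + 2 (∂ᵥu)²`. -/
theorem fderiv_fderiv_sq_apply {u : E → ℝ} (hu : ContDiff ℝ (⊤ : ℕ∞) u) (v x : E) :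
    fderiv ℝ (fun y => fderiv ℝ (fun z => u z ^ 2) y v) x v =
      2 * u x * fderiv ℝ (fun y => fderiv ℝ u y v) x v + 2 * (fderiv ℝ u x v) ^ 2 := by
  have hd : Differentiable ℝ u := hu.differentiable (by simp)
  have hd' : Differentiable ℝ (fun y => fderiv ℝ u y v) :=
    (hu.fderiv_apply_const v).differentiable (by simp)
  have h1 : (fun y => fderiv ℝ (fun z => u z ^ 2) y v) = fun y => 2 * u y * fderiv ℝ u y v := by
    funext y
    rw [((hd y).hasFDerivAt.pow 2).fderiv]
    simp
  rw [h1, (((hd x).hasFDerivAt.const_mul 2).fun_mul (hd' x).hasFDerivAt).fderiv]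
  simp
  ring

/-- The second directional derivative of a function rescaled by `c` around `x₀`. -/
theorem fderiv_fderiv_comp_smul_sub_apply {b : E → ℝ} (hb : ContDiff ℝ (⊤ : ℕ∞) b)
    (c : ℝ) (x₀ v x : E) :
    fderiv ℝ (fun y => fderiv ℝ (fun z => b (c • (z - x₀))) y v) x v =
      c ^ 2 * fderiv ℝ (fun y => fderiv ℝ b y v) (c • (x - x₀)) v := by
  have key : ∀ {g : E → ℝ}, Differentiable ℝ g → ∀ y,
      fderiv ℝ (fun z => g (c • (z - x₀))) y v = c * fderiv ℝ g (c • (y - x₀)) v := by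
    intro g hg y
    have h : HasFDerivAt (fun z : E => c • (z - x₀)) (c • ContinuousLinearMap.id ℝ E) y :=
      ((hasFDerivAt_id y).sub_const x₀).const_smul c
    have h' := (hg (c • (y - x₀))).hasFDerivAt.comp y h
    have := h'.fderiv
    simp only [Function.comp_def] at this
    rw [this]
    simp
  have hd' : Differentiable ℝ (fun y => fderiv ℝ b y v) :=
    (hb.fderiv_apply_const v).differentiable (by simp)
  have h1 : (fun y => fderiv ℝ (fun z => b (c • (z - x₀))) y v) =
      fun y => c * fderiv ℝ b (c • (y - x₀)) v :=
    funext (key (hb.differentiable (by simp)))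
  have hd'' : DifferentiableAt ℝ (fun y => fderiv ℝ b (c • (y - x₀)) v) x :=
    (hd' (c • (x - x₀))).comp (f := fun y : E => c • (y - x₀)) x (by fun_prop)
  rw [h1, fderiv_const_mul hd'']
  simp only [smul_apply, smul_eq_mul]
  rw [key hd']
  ring

variable [FiniteDimensional ℝ E] [MeasurableSpace E] [BorelSpace E]
  {μ : Measure E} [μ.IsAddHaarMeasure]

/-- Integrating by parts once against a compactly supported function. -/
theorem integral_mul_fderiv_eq_neg_of_hasCompactSupport {φ w : E → ℝ}
    (hφ : ContDiff ℝ (⊤ : ℕ∞) φ) (hφc : HasCompactSupport φ) (hw : ContDiff ℝ (⊤ : ℕ∞) w) (v : E) :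
    ∫ x, φ x * fderiv ℝ w x v ∂μ = - ∫ x, fderiv ℝ φ x v * w x ∂μ := by
  refine integral_mul_fderiv_eq_neg_fderiv_mul_of_integrable ?_ ?_ ?_
    (fun x _ => hφ.differentiable (by simp) x) (fun x _ => hw.differentiable (by simp) x)
  · exact ((hφ.fderiv_apply_const v).continuous.mul hw.continuous).integrable_of_hasCompactSupport
      (hφc.fderiv_apply ℝ v).mul_right
  · exact (hφ.continuous.mul (hw.fderiv_apply_const v).continuous).integrable_of_hasCompactSupport
      hφc.mul_right
  · exact (hφ.continuous.mul hw.continuous).integrable_of_hasCompactSupport hφc.mul_right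

/-- Integrating by parts twice against a compactly supported function. -/
theorem integral_mul_fderiv_fderiv_of_hasCompactSupport {φ w : E → ℝ}
    (hφ : ContDiff ℝ (⊤ : ℕ∞) φ) (hφc : HasCompactSupport φ) (hw : ContDiff ℝ (⊤ : ℕ∞) w) (v : E) :
    ∫ x, φ x * fderiv ℝ (fun y => fderiv ℝ w y v) x v ∂μ =
      ∫ x, fderiv ℝ (fun y => fderiv ℝ φ y v) x v * w x ∂μ := by
  rw [integral_mul_fderiv_eq_neg_of_hasCompactSupport hφ hφc (hw.fderiv_apply_const v),
    integral_mul_fderiv_eq_neg_of_hasCompactSupport (hφ.fderiv_apply_const v)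
      (hφc.fderiv_apply ℝ v) hw, neg_neg]

end SecondDirectionalDerivative

section EuclideanLaplacian

variable {n : ℕ}

theorem euclideanLap_eq_sum_fderiv {u : EuclideanSpace ℝ (Fin n) → ℝ}
    (hu : ContDiff ℝ (⊤ : ℕ∞) u) (x : EuclideanSpace ℝ (Fin n)) :
    euclideanLap u x = ∑ i : Fin n,
      fderiv ℝ (fun y => fderiv ℝ u y (EuclideanSpace.single i 1)) x
        (EuclideanSpace.single i 1) := by
  have hd : DifferentiableAt ℝ (fderiv ℝ u) x :=
    (hu.fderiv_right (m := (⊤ : ℕ∞)) (by simp)).differentiable (by simp) x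
  refine Finset.sum_congr rfl fun i _ => ?_
  rw [iteratedFDeriv_two_apply, fderiv_clm_apply hd (differentiableAt_const _)]
  simp

theorem contDiff_euclideanLap {u : EuclideanSpace ℝ (Fin n) → ℝ}
    (hu : ContDiff ℝ (⊤ : ℕ∞) u) : ContDiff ℝ (⊤ : ℕ∞) (euclideanLap u) := by
  rw [funext (euclideanLap_eq_sum_fderiv hu)]
  exact ContDiff.sum fun i _ => (hu.fderiv_apply_const _).fderiv_apply_const _

/-- Green's second identity against a compactly supported function. -/
theorem integral_mul_euclideanLap {φ w : EuclideanSpace ℝ (Fin n) → ℝ}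
    (hφ : ContDiff ℝ (⊤ : ℕ∞) φ) (hφc : HasCompactSupport φ) (hw : ContDiff ℝ (⊤ : ℕ∞) w) :
    ∫ x, φ x * euclideanLap w x = ∫ x, euclideanLap φ x * w x := by
  simp only [euclideanLap_eq_sum_fderiv hφ, euclideanLap_eq_sum_fderiv hw, Finset.mul_sum,
    Finset.sum_mul]
  rw [integral_finsetSum, integral_finsetSum]
  · exact Finset.sum_congr rfl fun i _ =>
      integral_mul_fderiv_fderiv_of_hasCompactSupport hφ hφc hw _
  · exact fun i _ => (((hφ.fderiv_apply_const _).fderiv_apply_const _).continuous.mul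
      hw.continuous).integrable_of_hasCompactSupport
      ((hφc.fderiv_apply ℝ _).fderiv_apply ℝ _).mul_right
  · exact fun i _ => (hφ.continuous.mul
      ((hw.fderiv_apply_const _).fderiv_apply_const _).continuous).integrable_of_hasCompactSupport
      hφc.mul_right

theorem euclideanLap_comp_smul_sub {b : EuclideanSpace ℝ (Fin n) → ℝ}
    (hb : ContDiff ℝ (⊤ : ℕ∞) b) (c : ℝ) (x₀ x : EuclideanSpace ℝ (Fin n)) :
    euclideanLap (fun z => b (c • (z - x₀))) x = c ^ 2 * euclideanLap b (c • (x - x₀)) := by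
  have hc : ContDiff ℝ (⊤ : ℕ∞) (fun z => b (c • (z - x₀))) := hb.comp (by fun_prop)
  simp only [euclideanLap_eq_sum_fderiv hc, euclideanLap_eq_sum_fderiv hb, Finset.mul_sum,
    fderiv_fderiv_comp_smul_sub_apply hb]

theorem euclideanLap_sq {u : EuclideanSpace ℝ (Fin n) → ℝ} (hu : ContDiff ℝ (⊤ : ℕ∞) u)
    (x : EuclideanSpace ℝ (Fin n)) :
    euclideanLap (fun z => u z ^ 2) x = 2 * u x * euclideanLap u x +
      2 * ∑ i : Fin n, (fderiv ℝ u x (EuclideanSpace.single i 1)) ^ 2 := by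
  simp only [euclideanLap_eq_sum_fderiv hu, euclideanLap_eq_sum_fderiv (hu.pow 2),
    fderiv_fderiv_sq_apply hu, Finset.sum_add_distrib, Finset.mul_sum]

theorem hasCompactSupport_euclideanLap {b : EuclideanSpace ℝ (Fin n) → ℝ}
    (hb : ContDiff ℝ (⊤ : ℕ∞) b) (hbc : HasCompactSupport b) :
    HasCompactSupport (euclideanLap b) := by
  refine HasCompactSupport.intro' hbc (isClosed_tsupport b) fun x hx => ?_
  rw [euclideanLap_eq_sum_fderiv hb]
  refine Finset.sum_eq_zero fun i _ => ?_
  have hsub := (tsupport_fderiv_apply_subset ℝ (f := fun y => fderiv ℝ b y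
    (EuclideanSpace.single i 1)) (EuclideanSpace.single i 1)).trans
    (tsupport_fderiv_apply_subset ℝ (EuclideanSpace.single i 1))
  exact image_eq_zero_of_notMem_tsupport (f := fun y => fderiv ℝ (fun y => fderiv ℝ b y
    (EuclideanSpace.single i 1)) y (EuclideanSpace.single i 1)) fun h => hx (hsub h)

/-- A square-integrable harmonic function on `ℝⁿ` has vanishing gradient. -/
theorem fderiv_eq_zero_of_euclideanLap_eq_zero_of_integrable_sq
    {u : EuclideanSpace ℝ (Fin n) → ℝ} (hu : ContDiff ℝ (⊤ : ℕ∞) u)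
    (hharm : ∀ x, euclideanLap u x = 0) (hint : Integrable (fun x => u x ^ 2) volume)
    (x₀ : EuclideanSpace ℝ (Fin n)) : fderiv ℝ u x₀ = 0 := by
  set g : EuclideanSpace ℝ (Fin n) → ℝ :=
    fun x => ∑ i : Fin n, (fderiv ℝ u x (EuclideanSpace.single i 1)) ^ 2 with hg
  have hgc : Continuous g :=
    continuous_finsetSum _ fun i _ => ((hu.fderiv_apply_const _).continuous).pow 2
  have hg0 : ∀ x, 0 ≤ g x := fun x => Finset.sum_nonneg fun i _ => sq_nonneg _
  let b : ContDiffBump (0 : EuclideanSpace ℝ (Fin n)) := ⟨1, 2, one_pos, one_lt_two⟩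
  have hb : ContDiff ℝ (⊤ : ℕ∞) b := b.contDiff
  have hbc : HasCompactSupport b := b.hasCompactSupport
  obtain ⟨C, hC⟩ :=
    (hasCompactSupport_euclideanLap hb hbc).exists_bound_of_continuous
      (contDiff_euclideanLap hb).continuous
  let ψ : ℝ → EuclideanSpace ℝ (Fin n) → ℝ := fun c x => b (c • (x - x₀))
  have hψ : ∀ c, ContDiff ℝ (⊤ : ℕ∞) (ψ c) := fun c => hb.comp (by fun_prop)
  have hψc : ∀ c, 0 < c → HasCompactSupport (ψ c) := fun c hc =>
    hbc.comp_homeomorph ((Homeomorph.subRight x₀).trans (Homeomorph.smulOfNeZero c hc.ne'))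
  have hψi : ∀ c, 0 < c → Integrable (fun x => ψ c x * g x) volume := fun c hc =>
    ((hψ c).continuous.mul hgc).integrable_of_hasCompactSupport (hψc c hc).mul_right
  have hbound : ∀ c, 0 < c → 2 * ∫ x, ψ c x * g x ≤ c ^ 2 * (C * ∫ x, u x ^ 2) := by
    intro c hc
    have h1 := integral_mul_euclideanLap (hψ c) (hψc c hc) (hu.pow 2)
    simp only [euclideanLap_sq hu, hharm, mul_zero, zero_add] at h1
    calc 2 * ∫ x, ψ c x * g x = ∫ x, euclideanLap (ψ c) x * u x ^ 2 := by
          rw [← h1, ← integral_const_mul]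
          exact integral_congr_ae (.of_forall fun x => by simp only [hg]; ring)
      _ ≤ ∫ x, c ^ 2 * (C * u x ^ 2) := by
          refine integral_mono ?_ ((hint.const_mul C).const_mul (c ^ 2)) fun x => ?_
          · exact ((contDiff_euclideanLap (hψ c)).continuous.mul
              (hu.continuous.pow 2)).integrable_of_hasCompactSupport
              (hasCompactSupport_euclideanLap (hψ c) (hψc c hc)).mul_right
          · simp only [ψ, euclideanLap_comp_smul_sub hb, mul_assoc]
            gcongr
            exact (le_abs_self _).trans (hC _)
      _ = c ^ 2 * (C * ∫ x, u x ^ 2) := by rw [integral_const_mul, integral_const_mul]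
  have hmono : ∀ c, 0 < c → c ≤ 1 / 2 → ∫ x, ψ 1 x * g x ≤ ∫ x, ψ c x * g x := by
    intro c hc hc2
    refine integral_mono (hψi 1 one_pos) (hψi c hc) fun x => ?_
    refine mul_le_mul_of_nonneg_right ?_ (hg0 x)
    by_cases hx : ‖x - x₀‖ ≤ 2
    · have : ψ c x = 1 := b.one_of_mem_closedBall (by
        simp only [mem_closedBall_zero_iff, norm_smul, Real.norm_eq_abs, abs_of_pos hc, b]
        nlinarith [norm_nonneg (x - x₀)])
      rw [this]
      exact b.le_one
    · have : ψ 1 x = 0 := b.zero_of_le_dist (by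
        simp only [one_smul, dist_zero_right, b]
        exact (not_le.mp hx).le)
      rw [this]
      exact b.nonneg
  have hle : ∫ x, ψ 1 x * g x ≤ 0 := by
    have hlim : Filter.Tendsto (fun c : ℝ => c ^ 2 * (C * ∫ x, u x ^ 2))
        (nhdsWithin 0 (Set.Ioi 0)) (nhds 0) := by
      have : Continuous fun c : ℝ => c ^ 2 * (C * ∫ x, u x ^ 2) := by fun_prop
      simpa using (this.tendsto 0).mono_left nhdsWithin_le_nhds
    have hev : ∀ᶠ c : ℝ in nhdsWithin 0 (Set.Ioi 0),
        2 * ∫ x, ψ 1 x * g x ≤ c ^ 2 * (C * ∫ x, u x ^ 2) := by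
      filter_upwards [Ioc_mem_nhdsGT (show (0 : ℝ) < 1 / 2 by norm_num)] with c hc
      linarith [hbound c hc.1, hmono c hc.1 hc.2]
    linarith [ge_of_tendsto hlim hev]
  have hgx : g x₀ = 0 := by
    by_contra hne
    refine hle.not_gt (((hψ 1).continuous.mul hgc).integral_pos_of_hasCompactSupport_nonneg_nonzero
      (hψc 1 one_pos).mul_right (fun x => mul_nonneg b.nonneg (hg0 x)) (x := x₀) ?_)
    have : ψ 1 x₀ = 1 := b.one_of_mem_closedBall (by simp [b])
    simpa [this] using hne
  have hi := (Finset.sum_eq_zero_iff_of_nonneg fun i _ => sq_nonneg _).mp hgx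
  refine ContinuousLinearMap.coe_injective
    ((EuclideanSpace.basisFun (Fin n) ℝ).toBasis.ext fun i => ?_)
  simpa using hi i (Finset.mem_univ i)

/-- A square-integrable harmonic function on `ℝⁿ`, with `n` positive, vanishes. -/
theorem eq_zero_of_euclideanLap_eq_zero_of_integrable_sq [Nonempty (Fin n)]
    {u : EuclideanSpace ℝ (Fin n) → ℝ} (hu : ContDiff ℝ (⊤ : ℕ∞) u)
    (hharm : ∀ x, euclideanLap u x = 0) (hint : Integrable (fun x => u x ^ 2) volume)
    (x : EuclideanSpace ℝ (Fin n)) : u x = 0 := by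
  have hconst : ∀ y, u y = u x := fun y =>
    is_const_of_fderiv_eq_zero (hu.differentiable (by simp))
      (fderiv_eq_zero_of_euclideanLap_eq_zero_of_integrable_sq hu hharm hint) y x
  simp only [hconst, integrable_const_iff] at hint
  rcases hint with h | h
  · simpa using h
  · have := NormedSpace.noncompactSpace ℝ (EuclideanSpace ℝ (Fin n))
    exact absurd (measure_univ_of_isAddLeftInvariant
      (volume : Measure (EuclideanSpace ℝ (Fin n)))) h.measure_univ_lt_top.ne

end EuclideanLaplacian

/-- A smooth biharmonic function `f : ℝⁿ → ℝ` (`Δ²f = 0`) with finite bienergy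
`∫|Δf|² < ∞` and finite energy `∫|∇f|² < ∞`, and with `Δf` and `∇f` bounded,
is harmonic: `Δf = 0`. -/
theorem biharmonic_finite_energy_is_harmonic {n : ℕ}
    (f : EuclideanSpace ℝ (Fin n) → ℝ) (hf : ContDiff ℝ (⊤ : ℕ∞) f)
    (hbih : ∀ x, euclideanLap (euclideanLap f) x = 0)
    (hE2 : Integrable (fun x => (euclideanLap f x) ^ 2) volume)
    (hE : Integrable (fun x => ‖fderiv ℝ f x‖ ^ 2) volume)
    (hb1 : ∃ C : ℝ, ∀ x, |euclideanLap f x| ≤ C)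
    (hb2 : ∃ C : ℝ, ∀ x, ‖fderiv ℝ f x‖ ≤ C) :
    ∀ x, euclideanLap f x = 0 := by
  intro x
  rcases isEmpty_or_nonempty (Fin n) with h | h
  · simp [euclideanLap]
  · exact eq_zero_of_euclideanLap_eq_zero_of_integrable_sq (contDiff_euclideanLap hf) hbih hE2 x
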